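/- arXiv:2109.07795 — 2 statements merged into one kernel-verified Lean document; each statement's English description precedes it below -/
import Mathlib

section
/- Let 𝕂 be ℝ or ℂ, let p ≥ 2 be an integer, and let Ψ : (𝕂,0) → (𝕂^n,0) be a non-zero analytic germ; set Φ(t) := Ψ(t^p). Then there exists a continuous function germ f : (ℝ,0) → (𝕂,0) with f(0)=0 such that Φ∘f is analytic but f is not of class C^1. -/
open Set Filter Topology Metric
open scoped ENNReal NNReal Topology

noncomputable section

namespace JorisPaper

/-- The sequence `m` with `m_k = M_k / k!`. -/
def lc (M : ℕ → ℝ) (k : ℕ) : ℝ := M k / (Nat.factorial k : ℝ)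

/-- A weight sequence: positive, log-convex, `M_0 = 1 ≤ M_1`, `M_k^{1/k} → ∞`. -/
structure IsWeightSeq (M : ℕ → ℝ) : Prop where
  pos : ∀ k, 0 < M k
  first : M 0 = 1
  one_le : 1 ≤ M 1
  logconvex : ∀ k, 1 ≤ k → M k ^ 2 ≤ M (k - 1) * M (k + 1)
  root : Filter.Tendsto (fun k : ℕ => M k ^ ((1 : ℝ) / (k : ℝ))) atTop atTop

/-- `m_k^{1/k} → ∞`. -/
def RootsTendsto (m : ℕ → ℝ) : Prop :=
  Filter.Tendsto (fun k : ℕ => m k ^ ((1 : ℝ) / (k : ℝ))) atTop atTop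

/-- `h_m(t) = inf_k m_k t^k` for `t > 0`, and `0` for `t ≤ 0`. -/
def hfn (m : ℕ → ℝ) (t : ℝ) : ℝ := if t ≤ 0 then 0 else ⨅ k : ℕ, m k * t ^ k

/-- `Γ̄_m(t) = min {k | h_m(t) = m_k t^k}`. -/
def GammaUpper (m : ℕ → ℝ) (t : ℝ) : ℕ := sInf {k : ℕ | hfn m t = m k * t ^ k}

/-- `Γ̲_m(t) = min {k | m_{k+1}/m_k ≥ 1/t}`. -/
def GammaLower (m : ℕ → ℝ) (t : ℝ) : ℕ := sInf {k : ℕ | 1 / t ≤ m (k + 1) / m k}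

/-- `mg(M,N) = sup_{j+k ≥ 1} (M_{j+k}/(N_j N_k))^{1/(j+k)}`, as an extended real. -/
def mg (M N : ℕ → ℝ) : ℝ≥0∞ :=
  ⨆ (j : ℕ) (k : ℕ) (_ : 1 ≤ j + k),
    ENNReal.ofReal ((M (j + k) / (N j * N k)) ^ (((j : ℝ) + (k : ℝ))⁻¹))

/-- A weight matrix: a totally ordered (pointwise) family of weight sequences. -/
structure IsWeightMatrix (W : Set (ℕ → ℝ)) : Prop where
  weight : ∀ M ∈ W, IsWeightSeq M
  ordered : ∀ M ∈ W, ∀ N ∈ W, (∀ k, M k ≤ N k) ∨ (∀ k, N k ≤ M k)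

/-- R-admissible weight matrix. -/
structure RAdmissible (W : Set (ℕ → ℝ)) : Prop where
  matrix : IsWeightMatrix W
  roots : ∀ M ∈ W, RootsTendsto (lc M)
  gamma : ∀ M ∈ W, ∃ N ∈ W, ∃ C : ℝ, 1 ≤ C ∧
    ∀ t : ℝ, 0 < t → GammaUpper (lc N) (C * t) ≤ GammaLower (lc M) t
  mgrowth : ∀ M ∈ W, ∃ N ∈ W, mg M N < ⊤

/-- B-admissible weight matrix. -/
structure BAdmissible (W : Set (ℕ → ℝ)) : Prop where
  matrix : IsWeightMatrix W
  roots : ∀ M ∈ W, RootsTendsto (lc M)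
  gamma : ∀ M ∈ W, ∃ N ∈ W, ∃ C : ℝ, 1 ≤ C ∧
    ∀ t : ℝ, 0 < t → GammaUpper (lc M) (C * t) ≤ GammaLower (lc N) t
  mgrowth : ∀ M ∈ W, ∃ N ∈ W, mg N M < ⊤

/-- `‖f‖^M_{K,ρ} < ∞` (derivatives taken within `U`). -/
def SeqBoundedOn {E F : Type*} [NormedAddCommGroup E] [NormedSpace ℝ E]
    [NormedAddCommGroup F] [NormedSpace ℝ F]
    (M : ℕ → ℝ) (ρ : ℝ) (f : E → F) (U K : Set E) : Prop :=
  ∃ C : ℝ, ∀ x ∈ K, ∀ k : ℕ, ‖iteratedFDerivWithin ℝ k f U x‖ ≤ C * ρ ^ k * M k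

/-- `f ∈ B^M_ρ(V)`: smooth on `V` with global bounds `‖f‖^M_{V,ρ} < ∞`. -/
def GlobalClass {E F : Type*} [NormedAddCommGroup E] [NormedSpace ℝ E]
    [NormedAddCommGroup F] [NormedSpace ℝ F]
    (M : ℕ → ℝ) (ρ : ℝ) (f : E → F) (V : Set E) : Prop :=
  ContDiffOn ℝ (⊤ : ℕ∞) f V ∧ SeqBoundedOn M ρ f V V

/-- The Roumieu class `E^{{W}}(U)`. -/
def Roumieu {E F : Type*} [NormedAddCommGroup E] [NormedSpace ℝ E]
    [NormedAddCommGroup F] [NormedSpace ℝ F]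
    (W : Set (ℕ → ℝ)) (U : Set E) (f : E → F) : Prop :=
  ContDiffOn ℝ (⊤ : ℕ∞) f U ∧
    ∀ K ⊆ U, IsCompact K → ∃ M ∈ W, ∃ ρ : ℝ, 0 < ρ ∧ SeqBoundedOn M ρ f U K

/-- The Beurling class `E^{(W)}(U)`. -/
def Beurling {E F : Type*} [NormedAddCommGroup E] [NormedSpace ℝ E]
    [NormedAddCommGroup F] [NormedSpace ℝ F]
    (W : Set (ℕ → ℝ)) (U : Set E) (f : E → F) : Prop :=
  ContDiffOn ℝ (⊤ : ℕ∞) f U ∧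
    ∀ K ⊆ U, IsCompact K → ∀ M ∈ W, ∀ ρ : ℝ, 0 < ρ → SeqBoundedOn M ρ f U K

/-- The open ellipse `Ω_ε` with vertices `±cosh ε` and co-vertices `±i sinh ε`. -/
def Omega (ε : ℝ) : Set ℂ :=
  {z : ℂ | (z.re / Real.cosh ε) ^ 2 + (z.im / Real.sinh ε) ^ 2 < 1}

/-- `V_U = ⋃_{x ∈ U} (x + 𝔹)`. -/
def VU {E : Type*} [NormedAddCommGroup E] [NormedSpace ℝ E] (U : Set E) : Set E :=
  ⋃ x ∈ U, Metric.closedBall x 1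

/-- A weight function in the sense of Braun–Meise–Taylor. -/
structure IsWeightFunction (ω : ℝ → ℝ) : Prop where
  cont : ContinuousOn ω (Ici 0)
  mono : MonotoneOn ω (Ici 0)
  nonneg : ∀ t, 0 ≤ t → 0 ≤ ω t
  bigO : (fun t => ω (2 * t)) =O[atTop] ω
  littleO : ω =o[atTop] (fun t => t)
  logLittleO : Real.log =o[atTop] ω
  convex : ConvexOn ℝ (Ici 0) (fun t => ω (Real.exp t))

/-- The Young conjugate `φ*_ω(s) = sup_{t ≥ 0} (s t - ω(e^t))`. -/
def youngConj (ω : ℝ → ℝ) (s : ℝ) : ℝ :=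
  sSup {y : ℝ | ∃ t : ℝ, 0 ≤ t ∧ y = s * t - ω (Real.exp t)}

/-- The Roumieu class `E^{{ω}}(U)` for a weight function `ω`. -/
def RoumieuW {E F : Type*} [NormedAddCommGroup E] [NormedSpace ℝ E]
    [NormedAddCommGroup F] [NormedSpace ℝ F]
    (ω : ℝ → ℝ) (U : Set E) (f : E → F) : Prop :=
  ContDiffOn ℝ (⊤ : ℕ∞) f U ∧
    ∀ K ⊆ U, IsCompact K → ∃ C : ℝ, 0 < C ∧ ∃ ρ : ℝ, 0 < ρ ∧
      ∀ x ∈ K, ∀ k : ℕ, ‖iteratedFDerivWithin ℝ k f U x‖ ≤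
        C * Real.exp ((1 / ρ) * youngConj ω (ρ * k))

/-- The Beurling class `E^{(ω)}(U)` for a weight function `ω`. -/
def BeurlingW {E F : Type*} [NormedAddCommGroup E] [NormedSpace ℝ E]
    [NormedAddCommGroup F] [NormedSpace ℝ F]
    (ω : ℝ → ℝ) (U : Set E) (f : E → F) : Prop :=
  ContDiffOn ℝ (⊤ : ℕ∞) f U ∧
    ∀ K ⊆ U, IsCompact K → ∀ ρ : ℝ, 0 < ρ → ∃ C : ℝ, 0 < C ∧
      ∀ x ∈ K, ∀ k : ℕ, ‖iteratedFDerivWithin ℝ k f U x‖ ≤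
        C * Real.exp ((1 / ρ) * youngConj ω (ρ * k))

/-- An odd power map on `ℝ` has a continuous right inverse vanishing at `0`. -/
theorem exists_continuous_odd_root {p : ℕ} (hp : Odd p) :
    ∃ g : ℝ → ℝ, Continuous g ∧ g 0 = 0 ∧ ∀ t, g t ^ p = t := by
  have hsurj : Function.Surjective (fun x : ℝ => x ^ p) :=
    (continuous_pow p).surjective (tendsto_pow_atTop hp.pos.ne') <| by
      simpa [Function.comp_def, hp.neg_pow] using
        tendsto_neg_atTop_atBot.comp
          ((tendsto_pow_atTop (α := ℝ) hp.pos.ne').comp tendsto_neg_atBot_atTop)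
  let e : ℝ ≃o ℝ := (hp.strictMono_pow (R := ℝ)).orderIsoOfSurjective _ hsurj
  have he : ∀ t, e.symm t ^ p = t := e.apply_symm_apply
  exact ⟨e.symm, e.symm.continuous, (pow_eq_zero_iff hp.pos.ne').1 (he 0), he⟩

/-- A `p`-th root of the identity vanishing at `0` is not differentiable there if `p ≥ 2`. -/
theorem not_differentiableAt_of_pow_eq_id {p : ℕ} (hp : 2 ≤ p) {g : ℝ → ℝ} (h0 : g 0 = 0)
    (hg : ∀ t, g t ^ p = t) : ¬ DifferentiableAt ℝ g 0 := by
  intro hd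
  have h1 := hd.hasDerivAt.pow p
  have h2 : HasDerivAt (g ^ p) 1 0 := by
    rw [show g ^ p = id from funext hg]
    exact hasDerivAt_id 0
  have h3 := h1.unique h2
  rw [h0, zero_pow (by omega)] at h3
  simp at h3

/-- For `p ≥ 2` there is a continuous real function, not differentiable at `0`, whose
`p`-th power is analytic. -/
theorem exists_continuous_not_differentiableAt_pow_analyticAt {p : ℕ} (hp : 2 ≤ p) :
    ∃ g : ℝ → ℝ, Continuous g ∧ g 0 = 0 ∧ AnalyticAt ℝ (fun t => g t ^ p) 0 ∧
      ¬ DifferentiableAt ℝ g 0 := by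
  rcases Nat.even_or_odd p with he | ho
  · refine ⟨fun t => |t|, continuous_abs, abs_zero, ?_, not_differentiableAt_abs_zero⟩
    simp only [he.pow_abs]
    exact analyticAt_id.pow p
  · obtain ⟨g, hc, h0, hg⟩ := exists_continuous_odd_root ho
    refine ⟨g, hc, h0, ?_, not_differentiableAt_of_pow_eq_id hp h0 hg⟩
    simp only [hg]
    exact analyticAt_id

/-- Necessity: if `Φ(t) = Ψ(t^p)` with `p ≥ 2`, there is a continuous non-`C¹` germ `f`
with `Φ ∘ f` analytic. -/
theorem statement17 {K : Type*} [RCLike K] {n : ℕ}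
    (p : ℕ) (hp : 2 ≤ p)
    (Psi : K → Fin n → K) (hPsia : AnalyticAt K Psi 0) (hPsi0 : Psi 0 = 0)
    (hPsine : ¬ ∀ᶠ t in 𝓝 (0 : K), Psi t = 0) :
    ∃ f : ℝ → K, f 0 = 0 ∧ (∀ᶠ x in 𝓝 (0 : ℝ), ContinuousAt f x) ∧
      AnalyticAt ℝ (fun t : ℝ => Psi (f t ^ p)) 0 ∧ ¬ ContDiffAt ℝ 1 f 0 := by
  obtain ⟨g, hc, h0, ha, hd⟩ := exists_continuous_not_differentiableAt_pow_analyticAt hp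
  refine ⟨fun t => (g t : K), by simp [h0],
    .of_forall fun x => (RCLike.continuous_ofReal.comp hc).continuousAt, ?_, fun hC => hd ?_⟩
  · have hpow : AnalyticAt ℝ (fun t => (g t : K) ^ p) 0 := by
      simpa [Function.comp_def] using
        ((RCLike.ofRealCLM (K := K)).analyticAt _).comp_of_eq ha rfl
    refine AnalyticAt.fun_comp (g := Psi) ?_ hpow
    have hz : (g 0 : K) ^ p = 0 := by simp [h0, show p ≠ 0 by omega]
    rw [hz]
    exact hPsia.restrictScalars
  · simpa [Function.comp_def] using
      (RCLike.reCLM (K := K)).differentiableAt.comp (0 : ℝ) (hC.differentiableAt one_ne_zero)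

end JorisPaper
end
end

section
/- Let 𝕂 be ℝ or ℂ, let p ≥ 2 be an integer, and let φ(t) = Σ_{1≤k<N} a_k t^{n_k} (with 1 ≤ N ≤ ∞) be a convergent power series with coefficients a_k ∈ 𝕂∖{0} and exponents 1 ≤ n_1 < n_2 < ⋯ such that gcd(p, n_1, n_2, …) = 1. Then there exist a positive integer q and germs α_0, …, α_{p−1} of 𝕂-analytic functions at 0 ∈ 𝕂 such that t^{1+pq} = Σ_{j=0}^{p−1} α_j(t^p)·φ(t)^j for all t in some neighborhood of 0 in 𝕂. -/
open Set Filter Topology Metric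
open scoped ENNReal NNReal Topology

noncomputable section

namespace JorisPaper

/-- The power series in `X` collecting the coefficients of `F` with index congruent to `r`
modulo `p`. -/
def residueSeries {R : Type*} [CommRing R] (p r : ℕ) (F : PowerSeries R) : PowerSeries R :=
  PowerSeries.mk fun n => PowerSeries.coeff (n * p + r) F

theorem sum_expand_residueSeries {R : Type*} [CommRing R] {p : ℕ} (hp : p ≠ 0)
    (F : PowerSeries R) :
    ∑ r : Fin p, PowerSeries.expand p hp (residueSeries p r F) * PowerSeries.X ^ (r : ℕ) = F := by
  ext n
  rw [map_sum, Finset.sum_eq_single ⟨n % p, Nat.mod_lt _ (Nat.pos_of_ne_zero hp)⟩]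
  · have h : n - n % p = p * (n / p) := by
      have := Nat.div_add_mod n p
      omega
    rw [PowerSeries.coeff_mul_X_pow', if_pos (Nat.mod_le _ _), h, PowerSeries.coeff_expand_mul,
      residueSeries, PowerSeries.coeff_mk, Nat.div_add_mod']
  · intro r _ hr
    rw [PowerSeries.coeff_mul_X_pow']
    split_ifs with hle
    · refine PowerSeries.coeff_expand_of_not_dvd _ _ _ fun ⟨k, hk⟩ => hr (Fin.ext ?_)
      have h : n = p * k + r := by omega
      simp [h, Nat.mod_eq_of_lt r.2]
    · rfl
  · simp

theorem expand_eq_zero {R : Type*} [CommRing R] {p : ℕ} (hp : p ≠ 0) {F : PowerSeries R}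
    (hF : PowerSeries.expand p hp F = 0) : F = 0 := by
  ext n
  rw [← PowerSeries.coeff_expand_mul p hp, hF, map_zero, map_zero]

theorem rescale_expand {R : Type*} [CommRing R] {p : ℕ} (hp : p ≠ 0) {ω : R} (hω : ω ^ p = 1)
    (F : PowerSeries R) :
    PowerSeries.rescale ω (PowerSeries.expand p hp F) = PowerSeries.expand p hp F := by
  ext n
  rw [PowerSeries.coeff_rescale]
  by_cases h : p ∣ n
  · obtain ⟨k, rfl⟩ := h
    rw [pow_mul, hω, one_pow, one_mul]
  · rw [PowerSeries.coeff_expand_of_not_dvd _ _ _ h, mul_zero]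

/-- The conjugates of a power series under a group of roots of unity are distinct as soon as its
support and `p` have no common divisor. -/
theorem rescale_rootsOfUnity_injective {L : Type*} [Field L] {p : ℕ} (F : PowerSeries L)
    (hgcd : ∀ m : ℕ, m ∣ p → (∀ k, PowerSeries.coeff k F ≠ 0 → m ∣ k) → m = 1) :
    Function.Injective fun ω : rootsOfUnity p L => PowerSeries.rescale ((ω : Lˣ) : L) F := by
  intro a b hab
  have hdiv : a / b = 1 := by
    rw [← orderOf_eq_one_iff]
    refine hgcd _ (orderOf_dvd_of_pow_eq_one ?_) fun k hk => orderOf_dvd_of_pow_eq_one ?_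
    · exact Subtype.ext (a / b).2
    · have h := congrArg (PowerSeries.coeff k) hab
      simp only [PowerSeries.coeff_rescale] at h
      have heq := mul_right_cancel₀ hk h
      rw [div_pow, div_eq_one]
      exact Subtype.ext (Units.ext (by simpa using heq))
  exact div_eq_one.mp hdiv

theorem det_residueSeries_ne_zero {K : Type*} [Field K] [CharZero K] {p : ℕ} (hp : p ≠ 0)
    (F : PowerSeries K)
    (hgcd : ∀ m : ℕ, m ∣ p → (∀ k, PowerSeries.coeff k F ≠ 0 → m ∣ k) → m = 1) :
    (Matrix.of fun j r : Fin p => residueSeries p r (F ^ (j : ℕ))).det ≠ 0 := by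
  intro hdet
  obtain ⟨v, hv, hvB⟩ := Matrix.exists_vecMul_eq_zero_iff.mpr hdet
  have hrel : ∑ j : Fin p, PowerSeries.expand p hp (v j) * F ^ (j : ℕ) = 0 := by
    calc ∑ j : Fin p, PowerSeries.expand p hp (v j) * F ^ (j : ℕ)
        = ∑ j : Fin p, PowerSeries.expand p hp (v j) * ∑ r : Fin p,
            PowerSeries.expand p hp (residueSeries p r (F ^ (j : ℕ))) * PowerSeries.X ^ (r : ℕ) := by
          simp_rw [sum_expand_residueSeries hp]
      _ = ∑ r : Fin p, PowerSeries.expand p hp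
            (∑ j : Fin p, v j * residueSeries p r (F ^ (j : ℕ))) * PowerSeries.X ^ (r : ℕ) := by
          simp_rw [Finset.mul_sum, map_sum, Finset.sum_mul, map_mul]
          rw [Finset.sum_comm]
          simp_rw [mul_assoc]
      _ = 0 := by
          refine Finset.sum_eq_zero fun r _ => ?_
          have h := congrFun hvB r
          simp only [Matrix.vecMul, dotProduct, Matrix.of_apply, Pi.zero_apply] at h
          rw [h, map_zero, zero_mul]
  let L := AlgebraicClosure K
  let ι := algebraMap K L
  have : NeZero p := ⟨hp⟩
  have : NeZero (p : L) := ⟨Nat.cast_ne_zero.mpr hp⟩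
  have := Fintype.ofFinite (rootsOfUnity p L)
  let Q : Polynomial (PowerSeries L) := ∑ j : Fin p,
    Polynomial.C (PowerSeries.expand p hp (PowerSeries.map ι (v j))) * Polynomial.X ^ (j : ℕ)
  have hQ : Q = 0 := by
    refine Polynomial.eq_zero_of_natDegree_lt_card_of_eval_eq_zero Q
      (rescale_rootsOfUnity_injective (p := p) (PowerSeries.map ι F) ?_) (fun ω => ?_) ?_
    · simpa using hgcd
    · have hω : ((ω : Lˣ) : L) ^ p = 1 := (mem_rootsOfUnity' p _).mp ω.2
      have h := congrArg (fun G => PowerSeries.rescale ((ω : Lˣ) : L) (PowerSeries.map ι G)) hrel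
      simpa [Q, Polynomial.eval_finsetSum, PowerSeries.map_expand, rescale_expand hp hω] using h
    · rw [← Nat.card_eq_fintype_card, HasEnoughRootsOfUnity.natCard_rootsOfUnity L p]
      have h : Q.degree < p := Polynomial.degree_sum_fin_lt _
      by_cases hQ : Q = 0
      · simpa [hQ] using Nat.pos_of_ne_zero hp
      · exact (Polynomial.natDegree_lt_iff_degree_lt hQ).mpr h
  refine hv (funext fun j => expand_eq_zero hp ?_)
  have h := congrArg (fun R : Polynomial (PowerSeries L) => R.coeff (j : ℕ)) hQ
  have hcoeff : Q.coeff (j : ℕ) = PowerSeries.expand p hp (PowerSeries.map ι (v j)) := by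
    simp [Q, Polynomial.coeff_C_mul, Polynomial.coeff_X_pow,
      Fin.val_inj]
  rw [← PowerSeries.map_expand] at hcoeff
  refine PowerSeries.map_injective ι ι.injective ?_
  simpa [← hcoeff] using h

/-- The ring of pairs of a function and a power series converging to it near `0`. -/
def convergentPairs (K : Type*) [RCLike K] : Subring ((K → K) × PowerSeries K) where
  carrier := {x | ∀ᶠ t in 𝓝 (0 : K), HasSum (fun n => PowerSeries.coeff n x.2 * t ^ n) (x.1 t)}
  zero_mem' := by simp [hasSum_zero]
  one_mem' := by
    refine Eventually.of_forall fun t => ?_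
    refine (hasSum_ite_eq 0 (1 : K)).congr_fun fun n => ?_
    by_cases h : n = 0 <;> simp [PowerSeries.coeff_one, h]
  add_mem' := by
    intro x y hx hy
    filter_upwards [hx, hy] with t h₁ h₂
    simpa [add_mul] using h₁.add h₂
  neg_mem' := by
    intro x hx
    filter_upwards [hx] with t h
    simpa using h.neg
  mul_mem' := by
    intro x y hx hy
    filter_upwards [hx, hy] with t h₁ h₂
    have n₁ := h₁.summable.norm
    have n₂ := h₂.summable.norm
    have hs := (summable_norm_sum_mul_antidiagonal_of_summable_norm n₁ n₂).of_norm.hasSum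
    rw [← tsum_mul_tsum_eq_tsum_sum_antidiagonal_of_summable_norm n₁ n₂, h₁.tsum_eq,
      h₂.tsum_eq] at hs
    refine hs.congr_fun fun n => ?_
    simp only [Prod.snd_mul, PowerSeries.coeff_mul, Finset.sum_mul]
    refine Finset.sum_congr rfl fun ij hij => ?_
    rw [← Finset.HasAntidiagonal.mem_antidiagonal.mp hij, pow_add]
    ring

theorem mem_convergentPairs {K : Type*} [RCLike K] {x : (K → K) × PowerSeries K} :
    x ∈ convergentPairs K ↔
      ∀ᶠ t in 𝓝 (0 : K), HasSum (fun n => PowerSeries.coeff n x.2 * t ^ n) (x.1 t) :=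
  Iff.rfl

theorem mem_convergentPairs_iff_hasFPowerSeriesAt {K : Type*} [RCLike K]
    {x : (K → K) × PowerSeries K} :
    x ∈ convergentPairs K ↔ HasFPowerSeriesAt x.1
      (FormalMultilinearSeries.ofScalars K fun n => PowerSeries.coeff n x.2) 0 := by
  rw [mem_convergentPairs, hasFPowerSeriesAt_iff]
  simp [FormalMultilinearSeries.coeff_ofScalars, mul_comm]

theorem analyticAt_of_mem_convergentPairs {K : Type*} [RCLike K] {x : (K → K) × PowerSeries K}
    (hx : x ∈ convergentPairs K) : AnalyticAt K x.1 0 :=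
  (mem_convergentPairs_iff_hasFPowerSeriesAt.mp hx).analyticAt

theorem snd_eq_zero_of_mem_convergentPairs {K : Type*} [RCLike K] {x : (K → K) × PowerSeries K}
    (hx : x ∈ convergentPairs K) (h : ∀ᶠ t in 𝓝 (0 : K), x.1 t = 0) : x.2 = 0 := by
  have heq := (mem_convergentPairs_iff_hasFPowerSeriesAt.mp hx).eq_zero_of_eventually h
  ext n
  rw [← FormalMultilinearSeries.coeff_ofScalars (𝕜 := K)
    (p := fun n => PowerSeries.coeff n x.2) (n := n), heq]
  rfl

/-- The sum of the residue series of `F`. -/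
def residueFun {K : Type*} [RCLike K] (p r : ℕ) (F : PowerSeries K) (s : K) : K :=
  ∑' n, PowerSeries.coeff n (residueSeries p r F) * s ^ n

theorem residueFun_mem_convergentPairs {K : Type*} [RCLike K] {p : ℕ} (hp : p ≠ 0) (r : ℕ)
    {x : (K → K) × PowerSeries K} (hx : x ∈ convergentPairs K) :
    (residueFun p r x.2, residueSeries p r x.2) ∈ convergentPairs K := by
  obtain ⟨t, ht, ht0⟩ : ∃ t : K,
      HasSum (fun n => PowerSeries.coeff n x.2 * t ^ n) (x.1 t) ∧ t ≠ 0 :=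
    (((mem_convergentPairs.mp hx).filter_mono nhdsWithin_le_nhds).and
      (self_mem_nhdsWithin : {0}ᶜ ∈ 𝓝[≠] (0 : K))).exists
  have hinj : Function.Injective fun n : ℕ => n * p + r := fun a b h => by
    simpa [hp] using h
  have hsum := (ht.summable.norm.comp_injective hinj).mul_right ((‖t‖ ^ r)⁻¹)
  have hball : ∀ᶠ s in 𝓝 (0 : K), ‖s‖ < ‖t‖ ^ p := by
    have : Metric.ball (0 : K) (‖t‖ ^ p) ∈ 𝓝 0 := Metric.ball_mem_nhds _ (by positivity)
    filter_upwards [this] with s hs using by simpa using hs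
  filter_upwards [hball] with s hs
  refine Summable.hasSum (Summable.of_norm_bounded hsum fun n => ?_)
  have h : (‖t‖ ^ (n * p + r)) * (‖t‖ ^ r)⁻¹ = (‖t‖ ^ p) ^ n := by
    rw [pow_add, mul_assoc, mul_inv_cancel₀ (by positivity), mul_one, mul_comm, pow_mul]
  simp only [residueSeries, PowerSeries.coeff_mk, Function.comp, norm_mul, norm_pow]
  rw [mul_assoc, h]
  gcongr

theorem eventually_eq_sum_residueFun {K : Type*} [RCLike K] {p : ℕ} (hp : p ≠ 0)
    {x : (K → K) × PowerSeries K} (hx : x ∈ convergentPairs K) :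
    ∀ᶠ t in 𝓝 (0 : K), x.1 t = ∑ r : Fin p, residueFun p r x.2 (t ^ p) * t ^ (r : ℕ) := by
  have : NeZero p := ⟨hp⟩
  have hlim : Tendsto (fun t : K => t ^ p) (𝓝 0) (𝓝 0) := by
    simpa [hp] using (continuous_pow p).tendsto (0 : K)
  have hres : ∀ r : Fin p, ∀ᶠ t in 𝓝 (0 : K),
      HasSum (fun n => PowerSeries.coeff n (residueSeries p r x.2) * (t ^ p) ^ n)
        (residueFun p r x.2 (t ^ p)) := fun r =>
    hlim.eventually (mem_convergentPairs.mp (residueFun_mem_convergentPairs hp r hx))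
  filter_upwards [mem_convergentPairs.mp hx, eventually_all.mpr hres] with t ht hr
  have h := (Equiv.prodComm _ _).hasSum_iff.mpr ((Nat.divModEquiv p).symm.hasSum_iff.mpr ht)
  refine (h.prod_fiberwise fun r => ?_).unique (hasSum_fintype _)
  refine ((hr r).mul_right (t ^ (r : ℕ))).congr_fun fun n => ?_
  simp [residueSeries, Nat.divModEquiv, pow_add, ← pow_mul, mul_comm, mul_assoc]

/-- The key algebraic identity `t^{1+pq} = Σ_{j<p} α_j(t^p) φ(t)^j`. -/
theorem statement18 {K : Type*} [RCLike K] (p : ℕ) (hp : 2 ≤ p)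
    (phi : K → K) (P : FormalMultilinearSeries K K K)
    (hphi : HasFPowerSeriesAt phi P 0) (h0 : P.coeff 0 = 0)
    (hgcd : ∀ m : ℕ, m ∣ p → (∀ k : ℕ, P.coeff k ≠ 0 → m ∣ k) → m = 1) :
    ∃ q : ℕ, 1 ≤ q ∧ ∃ α : Fin p → K → K,
      (∀ i, AnalyticAt K (α i) 0) ∧
      ∀ᶠ t in 𝓝 (0 : K),
        t ^ (1 + p * q) = ∑ i : Fin p, α i (t ^ p) * phi t ^ (i : ℕ) := by
  have hp0 : p ≠ 0 := by omega
  let F : PowerSeries K := PowerSeries.mk P.coeff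
  have hF : (phi, F) ∈ convergentPairs K := by
    rw [mem_convergentPairs]
    simpa [F, mul_comm] using hasFPowerSeriesAt_iff.mp hphi
  have hpow : ∀ j : ℕ, (phi ^ j, F ^ j) ∈ convergentPairs K := fun j => pow_mem hF j
  let M : Matrix (Fin p) (Fin p) (convergentPairs K) := Matrix.of fun j r =>
    ⟨_, residueFun_mem_convergentPairs hp0 (r : ℕ) (hpow j)⟩
  have hdet : (M.det : (K → K) × PowerSeries K).2 ≠ 0 := by
    let f := (RingHom.snd (K → K) (PowerSeries K)).comp (convergentPairs K).subtype
    change f M.det ≠ 0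
    rw [RingHom.map_det]
    exact det_residueSeries_ne_zero hp0 F (by simpa [F] using hgcd)
  obtain ⟨m, g, hg, hg0, hmg⟩ :=
    (analyticAt_of_mem_convergentPairs M.det.2).exists_eventuallyEq_pow_smul_nonzero_iff.mpr
      fun h => hdet (snd_eq_zero_of_mem_convergentPairs M.det.2 h)
  let e : Fin p := ⟨1, by omega⟩
  let A : Fin p → convergentPairs K := fun j => M.adjugate e j
  refine ⟨m + 1, by omega, fun j s => s * (A j : (K → K) × PowerSeries K).1 s / g s, fun j => ?_, ?_⟩
  · exact (analyticAt_id.mul (analyticAt_of_mem_convergentPairs (A j).2)).div hg hg0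
  have hlim : Tendsto (fun t : K => t ^ p) (𝓝 0) (𝓝 0) := by
    simpa [hp0] using (continuous_pow p).tendsto (0 : K)
  have hexp : ∀ j : Fin p, ∀ᶠ t in 𝓝 (0 : K), phi t ^ (j : ℕ) =
      ∑ r : Fin p, residueFun p r (F ^ (j : ℕ)) (t ^ p) * t ^ (r : ℕ) := fun j =>
    eventually_eq_sum_residueFun hp0 (hpow j)
  have hadj : ∀ (r : Fin p) (s : K),
      ∑ j : Fin p, (A j : (K → K) × PowerSeries K).1 s * residueFun p r (F ^ (j : ℕ)) s =
        if e = r then (M.det : (K → K) × PowerSeries K).1 s else 0 := by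
    intro r s
    let f := ((Pi.evalRingHom (fun _ : K => K) s).comp
      (RingHom.fst (K → K) (PowerSeries K))).comp (convergentPairs K).subtype
    have h := congrArg f (congrFun (congrFun M.adjugate_mul e) r)
    rw [Matrix.mul_apply, map_sum] at h
    simp only [map_mul, Matrix.smul_apply, Matrix.one_apply, smul_eq_mul, mul_ite, mul_one,
      mul_zero, apply_ite f, map_zero] at h
    exact h
  filter_upwards [eventually_all.mpr hexp, hlim.eventually hmg,
    hlim.eventually (hg.continuousAt.eventually_ne hg0)] with t ht hd hgt
  have key : ∑ j : Fin p, (A j : (K → K) × PowerSeries K).1 (t ^ p) * phi t ^ (j : ℕ) =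
      (t ^ p) ^ m * g (t ^ p) * t := by
    simp_rw [ht, Finset.mul_sum, ← mul_assoc]
    rw [Finset.sum_comm]
    simp_rw [← Finset.sum_mul, hadj, ite_mul, zero_mul]
    simp [hd, e]
  calc t ^ (1 + p * (m + 1))
      = t ^ p / g (t ^ p) * ((t ^ p) ^ m * g (t ^ p) * t) := by
        field_simp
        ring
    _ = _ := by
        rw [← key, Finset.mul_sum]
        refine Finset.sum_congr rfl fun j _ => ?_
        ring

end JorisPaper
end
end
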